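/- arXiv:2507.04441 — 9 statements merged into one kernel-verified Lean document; each statement's English description precedes it below -/
import Mathlib

section
/- Fix n ∈ ℕ, a compact Hausdorff topological space Y, and a nonempty closed set A ⊆ Y. Then the upper-envelope map (y^n, ψ) ↦ sup_{y ∈ A} π(y, y^n, ψ), defined on (Fin n → Y) × C((Fin n → Y) × Y, ℝ) with the product topology (uniform topology on the function space), is upper semicontinuous. -/
/-- The conformal transducer `π(y, y^n, ψ)`: with `z = Fin.snoc y^n y`, it is
`(n+1)⁻¹ · |{ i : Fin (n+1) | ψ(z₋ᵢ, z i) ≥ ψ(y^n, y) }|`, where `z₋ᵢ` is `z` with its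
`i`-th coordinate deleted. -/
noncomputable def transducer {Y : Type*} [TopologicalSpace Y] (n : ℕ)
    (y : Y) (yn : Fin n → Y) (ψ : C((Fin n → Y) × Y, ℝ)) : ℝ :=
  let z : Fin (n + 1) → Y := Fin.snoc yn y
  (Nat.card {i : Fin (n + 1) //
      ψ ((fun j => z (i.succAbove j)), z i) ≥ ψ (yn, y)} : ℝ) / (n + 1)

theorem transducer_eventually_le {Y : Type*} [TopologicalSpace Y] [CompactSpace Y] [T2Space Y]
    (n : ℕ) (p₀ : (Fin n → Y) × C((Fin n → Y) × Y, ℝ)) (y₀ : Y) :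
    ∀ᶠ q : ((Fin n → Y) × C((Fin n → Y) × Y, ℝ)) × Y in nhds (p₀, y₀),
      transducer n q.2 q.1.1 q.1.2 ≤ transducer n y₀ p₀.1 p₀.2 := by
  have hz : Continuous (fun q : ((Fin n → Y) × C((Fin n → Y) × Y, ℝ)) × Y =>
      (Fin.snoc q.1.1 q.2 : Fin (n + 1) → Y)) :=
    Continuous.finSnoc (by fun_prop) (by fun_prop)
  have hl : ∀ i : Fin (n + 1), Continuous
      (fun q : ((Fin n → Y) × C((Fin n → Y) × Y, ℝ)) × Y =>
        q.1.2 ((fun j => (Fin.snoc q.1.1 q.2 : Fin (n + 1) → Y) (i.succAbove j)),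
          (Fin.snoc q.1.1 q.2 : Fin (n + 1) → Y) i)) := by
    intro i
    have h1 : ∀ k : Fin (n + 1), Continuous
        (fun q : ((Fin n → Y) × C((Fin n → Y) × Y, ℝ)) × Y =>
          (Fin.snoc q.1.1 q.2 : Fin (n + 1) → Y) k) :=
      fun k => (continuous_apply k).comp hz
    exact (continuous_fst.snd).eval ((continuous_pi fun j => h1 _).prodMk (h1 i))
  have hr : Continuous (fun q : ((Fin n → Y) × C((Fin n → Y) × Y, ℝ)) × Y =>
      q.1.2 (q.1.1, q.2)) :=
    (continuous_fst.snd).eval (by fun_prop)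
  have key : ∀ᶠ q : ((Fin n → Y) × C((Fin n → Y) × Y, ℝ)) × Y in nhds (p₀, y₀),
      ∀ i : Fin (n + 1),
        q.1.2 ((fun j => (Fin.snoc q.1.1 q.2 : Fin (n + 1) → Y) (i.succAbove j)),
          (Fin.snoc q.1.1 q.2 : Fin (n + 1) → Y) i) ≥ q.1.2 (q.1.1, q.2) →
        p₀.2 ((fun j => (Fin.snoc p₀.1 y₀ : Fin (n + 1) → Y) (i.succAbove j)),
          (Fin.snoc p₀.1 y₀ : Fin (n + 1) → Y) i) ≥ p₀.2 (p₀.1, y₀) := by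
    rw [Filter.eventually_all]
    intro i
    by_cases h : p₀.2 ((fun j => (Fin.snoc p₀.1 y₀ : Fin (n + 1) → Y) (i.succAbove j)),
          (Fin.snoc p₀.1 y₀ : Fin (n + 1) → Y) i) ≥ p₀.2 (p₀.1, y₀)
    · exact Filter.Eventually.of_forall fun _ _ => h
    · have := (hl i).continuousAt.eventually_lt (hr.continuousAt (x := (p₀, y₀))) (not_le.mp h)
      filter_upwards [this] with q hq hq'
      exact absurd hq (not_lt.mpr hq')
  filter_upwards [key] with q hq
  unfold transducer
  refine div_le_div_of_nonneg_right (Nat.cast_le.mpr ?_) (by positivity)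
  refine Nat.card_le_card_of_injective (fun i => ⟨i.1, hq i.1 i.2⟩) ?_
  intro a b hab
  have hv := Subtype.ext_iff.mp hab
  exact Subtype.ext hv

theorem transducer_le_bound {Y : Type*} [TopologicalSpace Y] (n : ℕ)
    (y : Y) (yn : Fin n → Y) (ψ : C((Fin n → Y) × Y, ℝ)) : transducer n y yn ψ ≤ 1 := by
  unfold transducer
  refine div_le_one_of_le₀ ?_ (by positivity)
  have h := Nat.card_le_card_of_injective _ (Subtype.val_injective (p := fun i : Fin (n + 1) =>
      ψ ((fun j => (Fin.snoc yn y : Fin (n + 1) → Y) (i.succAbove j)),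
        (Fin.snoc yn y : Fin (n + 1) → Y) i) ≥ ψ (yn, y)))
  rw [Nat.card_fin] at h
  exact_mod_cast h

/-- For a compact Hausdorff space `Y` and a nonempty closed set `A ⊆ Y`, the upper-envelope
map `(y^n, ψ) ↦ sup_{y ∈ A} π(y, y^n, ψ)` is upper semicontinuous on
`(Fin n → Y) × C((Fin n → Y) × Y, ℝ)`. -/
theorem upperEnvelope_upperSemicontinuous
    {Y : Type*} [TopologicalSpace Y] [CompactSpace Y] [T2Space Y] (n : ℕ)
    (A : Set Y) (hA : A.Nonempty) (hAclosed : IsClosed A) :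
    UpperSemicontinuous (fun p : (Fin n → Y) × C((Fin n → Y) × Y, ℝ) =>
      sSup ((fun y => transducer n y p.1 p.2) '' A)) := by
  intro p₀ c hc
  have hK : IsCompact A := hAclosed.isCompact
  have h : ∀ᶠ p in nhds p₀, ∀ y ∈ A, transducer n y p.1 p.2 ≤
      sSup ((fun y => transducer n y p₀.1 p₀.2) '' A) := by
    apply hK.eventually_forall_of_forall_eventually
    intro y hy
    filter_upwards [transducer_eventually_le n p₀ y] with q hq
    refine hq.trans (le_csSup ⟨1, ?_⟩ ⟨y, hy, rfl⟩)
    rintro _ ⟨x, _, rfl⟩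
    exact transducer_le_bound n x _ _
  filter_upwards [h] with p hp
  refine lt_of_le_of_lt (csSup_le (hA.image _) ?_) hc
  rintro _ ⟨x, hx, rfl⟩
  exact hp x hx
end

section
/- Fix n ∈ ℕ and a compact Hausdorff topological space Y. The conformal transducer (y, y^n, ψ) ↦ π(y, y^n, ψ) is upper semicontinuous on Y × (Fin n → Y) × C((Fin n → Y) × Y, ℝ) with the product topology (uniform topology on the function space); equivalently, for every k ∈ {0, 1, …, n+1} the super-level set {(y, y^n, ψ) : π(y, y^n, ψ) ≥ k/(n+1)} is closed. -/
/-- For a compact Hausdorff space `Y`, the conformal transducer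
`(y, y^n, ψ) ↦ π(y, y^n, ψ)` is upper semicontinuous on
`Y × (Fin n → Y) × C((Fin n → Y) × Y, ℝ)`; equivalently, for every `k ∈ {0, …, n+1}` the
super-level set `{(y, y^n, ψ) : π(y, y^n, ψ) ≥ k/(n+1)}` is closed. -/
theorem transducer_upperSemicontinuous
    {Y : Type*} [TopologicalSpace Y] [CompactSpace Y] [T2Space Y] (n : ℕ) :
    UpperSemicontinuous (fun p : Y × (Fin n → Y) × C((Fin n → Y) × Y, ℝ) =>
      transducer n p.1 p.2.1 p.2.2) ∧
    ∀ k : ℕ, k ≤ n + 1 →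
      IsClosed {p : Y × (Fin n → Y) × C((Fin n → Y) × Y, ℝ) |
        transducer n p.1 p.2.1 p.2.2 ≥ (k : ℝ) / (n + 1)} := by
  have key : UpperSemicontinuous (fun p : Y × (Fin n → Y) × C((Fin n → Y) × Y, ℝ) =>
      transducer n p.1 p.2.1 p.2.2) := by
    have hz : Continuous (fun p : Y × (Fin n → Y) × C((Fin n → Y) × Y, ℝ) =>
        (Fin.snoc p.2.1 p.1 : Fin (n + 1) → Y)) :=
      Continuous.finSnoc (A := fun _ => Y) (continuous_fst.comp continuous_snd) continuous_fst
    have hR : Continuous (fun p : Y × (Fin n → Y) × C((Fin n → Y) × Y, ℝ) =>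
        p.2.2 (p.2.1, p.1)) := by fun_prop
    have hL : ∀ i : Fin (n + 1),
        Continuous (fun p : Y × (Fin n → Y) × C((Fin n → Y) × Y, ℝ) =>
        p.2.2 ((fun j => (Fin.snoc p.2.1 p.1 : Fin (n + 1) → Y) (i.succAbove j)),
          (Fin.snoc p.2.1 p.1 : Fin (n + 1) → Y) i)) := by
      intro i
      have h1 : ∀ i : Fin (n + 1),
          Continuous (fun p : Y × (Fin n → Y) × C((Fin n → Y) × Y, ℝ) =>
          (Fin.snoc p.2.1 p.1 : Fin (n + 1) → Y) i) := fun i => (continuous_apply i).comp hz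
      exact ContinuousEval.continuous_eval.comp ((continuous_snd.comp continuous_snd).prodMk
        ((continuous_pi fun j => h1 (i.succAbove j)).prodMk (h1 i)))
    intro p₀ c hc
    have hev : ∀ᶠ p in nhds p₀, ∀ i : Fin (n + 1),
        p.2.2 ((fun j => (Fin.snoc p.2.1 p.1 : Fin (n + 1) → Y) (i.succAbove j)),
          (Fin.snoc p.2.1 p.1 : Fin (n + 1) → Y) i) ≥ p.2.2 (p.2.1, p.1) →
        p₀.2.2 ((fun j => (Fin.snoc p₀.2.1 p₀.1 : Fin (n + 1) → Y) (i.succAbove j)),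
          (Fin.snoc p₀.2.1 p₀.1 : Fin (n + 1) → Y) i) ≥ p₀.2.2 (p₀.2.1, p₀.1) := by
      rw [Filter.eventually_all]
      intro i
      by_cases h : p₀.2.2 ((fun j => (Fin.snoc p₀.2.1 p₀.1 : Fin (n + 1) → Y) (i.succAbove j)),
          (Fin.snoc p₀.2.1 p₀.1 : Fin (n + 1) → Y) i) ≥ p₀.2.2 (p₀.2.1, p₀.1)
      · exact Filter.Eventually.of_forall fun _ _ => h
      · have h' := (hL i).continuousAt.eventually_lt hR.continuousAt (not_le.mp h)
        filter_upwards [h'] with p hp hp2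
        exact absurd hp2 (not_le.mpr hp)
    filter_upwards [hev] with p hp
    refine lt_of_le_of_lt ?_ hc
    simp only [transducer]
    refine div_le_div_of_nonneg_right ?_ (by positivity)
    refine Nat.cast_le.mpr ?_
    refine Nat.card_le_card_of_injective (fun a => ⟨a.1, hp a.1 a.2⟩) ?_
    intro a b hab
    exact Subtype.ext (Subtype.mk.inj hab)
  exact ⟨key, fun k _ => key.isClosed_preimage _⟩
end

section
/- Fix n ∈ ℕ, a compact Hausdorff topological space Y, and α ∈ [0,1] with α ∉ S_{n+1} := {k/(n+1) : k = 0, 1, …, n+1}. Then the graph of the conformal prediction correspondence at level α, namely the set {(y^n, ψ, y) ∈ (Fin n → Y) × C((Fin n → Y) × Y, ℝ) × Y : π(y, y^n, ψ) > α}, is closed in the product topology (uniform topology on the function space). In particular, since π takes values in the grid S_{n+1}, this set equals {(y^n, ψ, y) : π(y, y^n, ψ) ≥ β(α)}, where β(α) := min{ s ∈ S_{n+1} : s > α }. -/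
/-- The grid `S_{n+1} = {k/(n+1) : k = 0, 1, …, n+1}` of possible transducer values. -/
def grid (n : ℕ) : Set ℝ := {s : ℝ | ∃ k : ℕ, k ≤ n + 1 ∧ s = (k : ℝ) / (n + 1)}

theorem transducer_mem_grid {Y : Type*} [TopologicalSpace Y] (n : ℕ)
    (y : Y) (yn : Fin n → Y) (ψ : C((Fin n → Y) × Y, ℝ)) :
    transducer n y yn ψ ∈ grid n := by
  refine ⟨_, ?_, rfl⟩
  refine (Finite.card_subtype_le _).trans ?_
  simp

theorem continuous_score {Y : Type*} [TopologicalSpace Y] [CompactSpace Y] [T2Space Y] (n : ℕ)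
    (i : Fin (n + 1)) :
    Continuous (fun p : (Fin n → Y) × C((Fin n → Y) × Y, ℝ) × Y =>
      p.2.1 ((fun j => (Fin.snoc p.1 p.2.2 : Fin (n + 1) → Y) (i.succAbove j)),
        (Fin.snoc p.1 p.2.2 : Fin (n + 1) → Y) i)) := by
  have hz : Continuous (fun p : (Fin n → Y) × C((Fin n → Y) × Y, ℝ) × Y =>
      (Fin.snoc p.1 p.2.2 : Fin (n + 1) → Y)) :=
    Continuous.finSnoc (A := fun _ => Y) continuous_fst (continuous_snd.comp continuous_snd)
  have hz' := fun k => (continuous_apply k).comp hz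
  have h1 : Continuous (fun p : (Fin n → Y) × C((Fin n → Y) × Y, ℝ) × Y => p.2.1) := by fun_prop
  exact h1.eval ((continuous_pi fun j => hz' (i.succAbove j)).prodMk (hz' i))

/-- For a compact Hausdorff space `Y` and `α ∈ [0,1]` with `α ∉ S_{n+1}`, the graph
`{(y^n, ψ, y) : π(y, y^n, ψ) > α}` of the conformal prediction correspondence is closed;
moreover it equals the set `{(y^n, ψ, y) : π(y, y^n, ψ) ≥ β(α)}`, where
`β(α) = min{s ∈ S_{n+1} : s > α}`. -/
theorem conformal_graph_closed
    {Y : Type*} [TopologicalSpace Y] [CompactSpace Y] [T2Space Y] (n : ℕ)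
    (α : ℝ) (hα0 : 0 ≤ α) (hα1 : α ≤ 1) (hα : α ∉ grid n) :
    IsClosed {p : (Fin n → Y) × C((Fin n → Y) × Y, ℝ) × Y |
      transducer n p.2.2 p.1 p.2.1 > α} ∧
    {p : (Fin n → Y) × C((Fin n → Y) × Y, ℝ) × Y | transducer n p.2.2 p.1 p.2.1 > α} =
      {p : (Fin n → Y) × C((Fin n → Y) × Y, ℝ) × Y |
        transducer n p.2.2 p.1 p.2.1 ≥ sInf {s : ℝ | s ∈ grid n ∧ s > α}} := by
  constructor
  · rw [← isOpen_compl_iff, isOpen_iff_mem_nhds]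
    intro p₀ hp₀
    have hp₀' : transducer n p₀.2.2 p₀.1 p₀.2.1 ≤ α := not_lt.mp hp₀
    have hc : Continuous (fun p : (Fin n → Y) × C((Fin n → Y) × Y, ℝ) × Y =>
        p.2.1 (p.1, p.2.2)) := by
      have h1 : Continuous (fun p : (Fin n → Y) × C((Fin n → Y) × Y, ℝ) × Y => p.2.1) := by
        fun_prop
      exact h1.eval (by fun_prop)
    have key : ∀ᶠ p in nhds p₀, ∀ i : Fin (n + 1),
        p₀.2.1 ((fun j => (Fin.snoc p₀.1 p₀.2.2 : Fin (n + 1) → Y) (i.succAbove j)),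
          (Fin.snoc p₀.1 p₀.2.2 : Fin (n + 1) → Y) i) < p₀.2.1 (p₀.1, p₀.2.2) →
        p.2.1 ((fun j => (Fin.snoc p.1 p.2.2 : Fin (n + 1) → Y) (i.succAbove j)),
          (Fin.snoc p.1 p.2.2 : Fin (n + 1) → Y) i) < p.2.1 (p.1, p.2.2) := by
      rw [Filter.eventually_all]
      intro i
      rw [Filter.eventually_imp_distrib_left]
      intro hi
      exact (continuous_score n i).continuousAt.eventually_lt hc.continuousAt hi
    filter_upwards [key] with p hp
    refine not_lt.mpr (le_trans ?_ hp₀')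
    unfold transducer
    dsimp only
    gcongr
    refine Nat.card_le_card_of_injective
      (Subtype.map id fun i hi => ?_) (Subtype.map_injective _ Function.injective_id)
    exact not_lt.mp fun h => absurd (hp i h) (not_lt.mpr hi)
  · have hfin : {s : ℝ | s ∈ grid n ∧ s > α}.Finite := by
      refine ((Set.finite_Iic (n + 1)).image (fun k : ℕ => (k : ℝ) / (n + 1))).subset ?_
      rintro s ⟨⟨k, hk, rfl⟩, -⟩
      exact ⟨k, hk, rfl⟩
    have h1 : (1 : ℝ) ∈ grid n := ⟨n + 1, le_rfl, by
      push_cast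
      exact (div_self (by positivity)).symm⟩
    have hne : {s : ℝ | s ∈ grid n ∧ s > α}.Nonempty :=
      ⟨1, h1, lt_of_le_of_ne hα1 fun h => hα (h ▸ h1)⟩
    have hmem := hne.csInf_mem hfin
    ext p
    constructor
    · intro hp
      exact csInf_le hfin.bddBelow ⟨transducer_mem_grid _ _ _ _, hp⟩
    · intro hp
      exact lt_of_lt_of_le hmem.2 hp
end

section
/- Fix n ∈ ℕ, a compact metric space Y, and α ∈ [0,1] with α ∉ S_{n+1} := {k/(n+1) : k = 0, 1, …, n+1}. Then the conformal prediction correspondence κ_α(y^n, ψ) := {y ∈ Y : π(y, y^n, ψ) > α} is weakly measurable: for every open set G ⊆ Y, the set {(y^n, ψ) ∈ (Fin n → Y) × C((Fin n → Y) × Y, ℝ) : ∃ y ∈ G, π(y, y^n, ψ) > α} is Borel with respect to the product topology (uniform topology on the function space). -/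
theorem transducer_gt_iff {Y : Type*} [TopologicalSpace Y] (n : ℕ) (α : ℝ)
    (y : Y) (yn : Fin n → Y) (ψ : C((Fin n → Y) × Y, ℝ)) :
    transducer n y yn ψ > α ↔ ∃ S : Finset (Fin (n + 1)), α < (S.card : ℝ) / (n + 1) ∧
      ∀ i ∈ S, ψ (yn, y) ≤ ψ ((fun j => (Fin.snoc yn y : Fin (n + 1) → Y) (i.succAbove j)),
        (Fin.snoc yn y : Fin (n + 1) → Y) i) := by
  classical
  unfold transducer
  simp only [Nat.card_eq_fintype_card, Fintype.card_subtype, gt_iff_lt, ge_iff_le]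
  constructor
  · intro h
    exact ⟨_, h, fun i hi => (Finset.mem_filter.1 hi).2⟩
  · rintro ⟨S, h, hS⟩
    refine h.trans_le ?_
    gcongr
    intro i hi
    exact Finset.mem_filter.2 ⟨Finset.mem_univ _, hS i hi⟩

theorem isClosed_transducer_gt {Y : Type*} [MetricSpace Y] [CompactSpace Y] (n : ℕ) (α : ℝ) :
    IsClosed {q : Y × ((Fin n → Y) × C((Fin n → Y) × Y, ℝ)) |
      transducer n q.1 q.2.1 q.2.2 > α} := by
  simp only [transducer_gt_iff, Set.setOf_exists]
  refine isClosed_iUnion_of_finite fun S => ?_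
  simp only [Set.setOf_and, Set.setOf_forall]
  refine isClosed_const.inter (isClosed_iInter fun i => isClosed_iInter fun _ => ?_)
  have hz : Continuous fun q : Y × ((Fin n → Y) × C((Fin n → Y) × Y, ℝ)) =>
      (Fin.snoc q.2.1 q.1 : Fin (n + 1) → Y) := by
    refine continuous_pi fun k => ?_
    refine Fin.lastCases ?_ (fun j => ?_) k
    · simpa using continuous_fst
    · simp only [Fin.snoc_castSucc]
      fun_prop
  refine isClosed_le ?_ ?_
  · exact ContinuousEval.continuous_eval.comp
      (g := fun r : C((Fin n → Y) × Y, ℝ) × ((Fin n → Y) × Y) => r.1 r.2)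
      (f := fun q : Y × ((Fin n → Y) × C((Fin n → Y) × Y, ℝ)) => (q.2.2, (q.2.1, q.1)))
      (by fun_prop)
  · have h2 : Continuous fun q : Y × ((Fin n → Y) × C((Fin n → Y) × Y, ℝ)) =>
        (q.2.2, ((fun j => (Fin.snoc q.2.1 q.1 : Fin (n + 1) → Y) (i.succAbove j)),
          (Fin.snoc q.2.1 q.1 : Fin (n + 1) → Y) i)) := by
      refine (continuous_snd.comp continuous_snd).prodMk (Continuous.prodMk ?_ ?_)
      · exact continuous_pi fun j => (continuous_apply (i.succAbove j)).comp hz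
      · exact (continuous_apply i).comp hz
    exact ContinuousEval.continuous_eval.comp
      (g := fun r : C((Fin n → Y) × Y, ℝ) × ((Fin n → Y) × Y) => r.1 r.2) h2

/-- For a compact metric space `Y` and `α ∈ [0,1]` with `α ∉ S_{n+1}`, the conformal
prediction correspondence `κ_α(y^n, ψ) = {y : π(y, y^n, ψ) > α}` is weakly measurable:
for every open `G ⊆ Y`, the set `{(y^n, ψ) : ∃ y ∈ G, π(y, y^n, ψ) > α}` is Borel in the
product topology. -/
theorem conformal_correspondence_weaklyMeasurable
    {Y : Type*} [MetricSpace Y] [CompactSpace Y] (n : ℕ)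
    (α : ℝ) (hα0 : 0 ≤ α) (hα1 : α ≤ 1) (hα : α ∉ grid n) :
    ∀ G : Set Y, IsOpen G →
      @MeasurableSet ((Fin n → Y) × C((Fin n → Y) × Y, ℝ))
        (borel ((Fin n → Y) × C((Fin n → Y) × Y, ℝ)))
        {p : (Fin n → Y) × C((Fin n → Y) × Y, ℝ) |
          ∃ y ∈ G, transducer n y p.1 p.2 > α} := by
  intro G hG
  obtain ⟨F, hF, -, hFG, -⟩ := hG.exists_iUnion_isClosed
  have key : {p : (Fin n → Y) × C((Fin n → Y) × Y, ℝ) | ∃ y ∈ G, transducer n y p.1 p.2 > α} =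
      ⋃ k, Prod.snd '' ((Prod.fst ⁻¹' F k) ∩
        {q : Y × ((Fin n → Y) × C((Fin n → Y) × Y, ℝ)) | transducer n q.1 q.2.1 q.2.2 > α}) := by
    ext p
    simp only [← hFG, Set.mem_setOf_eq, Set.mem_iUnion, Set.mem_image, Set.mem_inter_iff,
      Set.mem_preimage]
    constructor
    · rintro ⟨y, ⟨k, hk⟩, hy⟩
      exact ⟨k, (y, p), ⟨hk, hy⟩, rfl⟩
    · rintro ⟨k, ⟨y, p'⟩, ⟨hk, hy⟩, rfl⟩
      exact ⟨y, ⟨k, hk⟩, hy⟩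
  rw [key]
  letI : MeasurableSpace ((Fin n → Y) × C((Fin n → Y) × Y, ℝ)) := borel _
  haveI : BorelSpace ((Fin n → Y) × C((Fin n → Y) × Y, ℝ)) := ⟨rfl⟩
  refine MeasurableSet.iUnion fun k => IsClosed.measurableSet ?_
  exact isClosedMap_snd_of_compactSpace _
    (((hF k).preimage continuous_fst).inter (isClosed_transducer_gt n α))
end

section
/- Let (Θ, Σ_Θ) be a measurable space with a σ-finite measure λ, let Y be a compact metric space, and fix n ∈ ℕ. Let a : Θ × (Fin (n+1) → Y) → ℝ and b : Θ × (Fin n → Y) → ℝ be nonnegative, measurable in θ for each fixed tuple, and such that for λ-almost every θ the maps a(θ, ·) and b(θ, ·) are continuous. Let p, M : Θ → ℝ be nonnegative measurable functions with a(θ, w) ≤ M(θ) and b(θ, v) ≤ M(θ) for all tuples w, v and λ-almost every θ, and with ∫_Θ p·M dλ < ∞. Assume D(v) := ∫_Θ b(θ, v)·p(θ) dλ(θ) > 0 for every v : Fin n → Y. Then the posterior-predictive map (v, y) ↦ N(v, y) / D(v), where N(v, y) := ∫_Θ a(θ, Fin.snoc v y)·p(θ) dλ(θ), is jointly continuous on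 (Fin n → Y) × Y. -/
open MeasureTheory

/-- Posterior-predictive continuity: with a de Finetti kernel `a = k_{n+1}`, `b = k_n`,
prior density `p`, integrable envelope `M`, and strictly positive marginal likelihood
`D(v) = ∫ b(θ,v) p(θ) dλ`, the posterior predictive map
`(v, y) ↦ N(v, y)/D(v)`, with `N(v,y) = ∫ a(θ, snoc v y) p(θ) dλ`, is jointly continuous. -/
theorem posterior_predictive_continuous
    {Θ : Type*} [MeasurableSpace Θ] (lam : Measure Θ) [SigmaFinite lam]
    {Y : Type*} [MetricSpace Y] [CompactSpace Y] (n : ℕ)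
    (a : Θ × (Fin (n + 1) → Y) → ℝ) (b : Θ × (Fin n → Y) → ℝ)
    (ha0 : ∀ θ w, 0 ≤ a (θ, w)) (hb0 : ∀ θ v, 0 ≤ b (θ, v))
    (hameas : ∀ w, Measurable fun θ => a (θ, w))
    (hbmeas : ∀ v, Measurable fun θ => b (θ, v))
    (hacont : ∀ᵐ θ ∂lam, Continuous fun w => a (θ, w))
    (hbcont : ∀ᵐ θ ∂lam, Continuous fun v => b (θ, v))
    (p M : Θ → ℝ) (hp0 : ∀ θ, 0 ≤ p θ) (hM0 : ∀ θ, 0 ≤ M θ)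
    (hpmeas : Measurable p) (hMmeas : Measurable M)
    (haM : ∀ᵐ θ ∂lam, ∀ w, a (θ, w) ≤ M θ)
    (hbM : ∀ᵐ θ ∂lam, ∀ v, b (θ, v) ≤ M θ)
    (hpM : ∫⁻ θ, ENNReal.ofReal (p θ * M θ) ∂lam < ⊤)
    (hD : ∀ v : Fin n → Y, 0 < ∫ θ, b (θ, v) * p θ ∂lam) :
    Continuous fun q : (Fin n → Y) × Y =>
      (∫ θ, a (θ, Fin.snoc q.1 q.2) * p θ ∂lam) / (∫ θ, b (θ, q.1) * p θ ∂lam) := by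
  have hint : Integrable (fun θ => p θ * M θ) lam := by
    refine ⟨(hpmeas.mul hMmeas).aestronglyMeasurable, ?_⟩
    rw [hasFiniteIntegral_iff_ofReal (Filter.Eventually.of_forall fun θ => mul_nonneg (hp0 θ) (hM0 θ))]
    exact hpM
  refine Continuous.div ?_ ?_ (fun q => (hD q.1).ne')
  · refine continuous_of_dominated (bound := fun θ => p θ * M θ)
      (fun q => ((hameas _).mul hpmeas).aestronglyMeasurable) (fun q => ?_) hint ?_
    · filter_upwards [haM] with θ h
      rw [Real.norm_of_nonneg (mul_nonneg (ha0 _ _) (hp0 _)), mul_comm]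
      exact mul_le_mul_of_nonneg_left (h _) (hp0 θ)
    · filter_upwards [hacont] with θ h
      have hs : Continuous fun q : (Fin n → Y) × Y =>
          (Fin.snoc q.1 q.2 : Fin (n + 1) → Y) :=
        Continuous.finSnoc (A := fun _ => Y) continuous_fst continuous_snd
      exact (h.comp hs).mul continuous_const
  · refine continuous_of_dominated (bound := fun θ => p θ * M θ)
      (fun q => ((hbmeas _).mul hpmeas).aestronglyMeasurable) (fun q => ?_) hint ?_
    · filter_upwards [hbM] with θ h
      rw [Real.norm_of_nonneg (mul_nonneg (hb0 _ _) (hp0 _)), mul_comm]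
      exact mul_le_mul_of_nonneg_left (h _) (hp0 θ)
    · filter_upwards [hbcont] with θ h
      exact (h.comp continuous_fst).mul continuous_const
end

section
/- In the setting of the posterior-predictive continuity lemma (Θ measurable with σ-finite λ; Y compact metric; a, b nonnegative kernels measurable in θ and continuous in the tuple for λ-a.e. θ; envelope M with a(θ,·) ≤ M(θ), b(θ,·) ≤ M(θ) a.e.; p nonnegative measurable with ∫ p·M dλ < ∞ and D_p(v) := ∫ b(θ,v) p(θ) dλ > 0 for all v), let (p_m) be a sequence of nonnegative measurable functions with ∫_Θ |p_m − p|·M dλ → 0. Then sup over all (v, y) of |N_{p_m}(v, y) − N_p(v, y)| → 0 and sup over all v of |D_{p_m}(v) − D_p(v)| → 0; moreover, since D_p is continuous and strictly positive on the compact space (Fin n → Y), it is bounded below by a positive constant, and consequently the posterior predictive densities N_{p_m}/D_{p_m} converge uniformly on (Fin n → Y) × Y to N_p/D_p. -/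
open MeasureTheory Filter

lemma unif_of_bound {X : Type*} (F : ℕ → X → ℝ) (f : X → ℝ) (e : ℕ → ℝ)
    (he : Tendsto e atTop (nhds 0)) (h : ∀ᶠ m in atTop, ∀ x, |F m x - f x| ≤ e m) :
    TendstoUniformly F f atTop := by
  rw [Metric.tendstoUniformly_iff]
  intro ε hε
  filter_upwards [h, he.eventually (gt_mem_nhds hε)] with m hm hlt x
  rw [dist_comm, Real.dist_eq]
  exact (hm x).trans_lt hlt

lemma int_of_env {Θ : Type*} [MeasurableSpace Θ] (lam : Measure Θ)
    (k r M : Θ → ℝ) (hk0 : ∀ θ, 0 ≤ k θ) (hk : Measurable k) (hr : Measurable r)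
    (hkM : ∀ᵐ θ ∂lam, k θ ≤ M θ) (hrM : Integrable (fun θ => |r θ| * M θ) lam) :
    Integrable (fun θ => k θ * r θ) lam ∧
      |∫ θ, k θ * r θ ∂lam| ≤ ∫ θ, |r θ| * M θ ∂lam := by
  have hb : ∀ᵐ θ ∂lam, ‖k θ * r θ‖ ≤ |r θ| * M θ := by
    filter_upwards [hkM] with θ h
    rw [Real.norm_eq_abs, abs_mul, abs_of_nonneg (hk0 θ), mul_comm]
    exact mul_le_mul_of_nonneg_left h (abs_nonneg _)
  exact ⟨hrM.mono' (hk.mul hr).aestronglyMeasurable hb,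
    norm_integral_le_of_norm_le hrM hb⟩

lemma diff_bound {Θ : Type*} [MeasurableSpace Θ] (lam : Measure Θ)
    (k p p' M : Θ → ℝ) (hk0 : ∀ θ, 0 ≤ k θ) (hk : Measurable k) (hp : Measurable p)
    (hp' : Measurable p')
    (hkM : ∀ᵐ θ ∂lam, k θ ≤ M θ) (hpM : Integrable (fun θ => |p θ| * M θ) lam)
    (hdM : Integrable (fun θ => |p' θ - p θ| * M θ) lam) :
    |(∫ θ, k θ * p' θ ∂lam) - ∫ θ, k θ * p θ ∂lam| ≤ ∫ θ, |p' θ - p θ| * M θ ∂lam := by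
  obtain ⟨h1, -⟩ := int_of_env lam k p M hk0 hk hp hkM hpM
  obtain ⟨h2, h3⟩ := int_of_env lam k (fun θ => p' θ - p θ) M hk0 hk (hp'.sub hp) hkM hdM
  have h4 : Integrable (fun θ => k θ * p' θ) lam := by
    refine (h2.add h1).congr (Eventually.of_forall fun θ => ?_)
    simp only [Pi.add_apply]; ring
  rw [← integral_sub h4 h1]
  simpa only [mul_sub] using h3

lemma div_bound {N D N' D' B c e : ℝ} (hc : 0 < c) (hN : |N| ≤ B)
    (hD : c ≤ D) (h1 : |N' - N| ≤ e) (h2 : |D' - D| ≤ e) (hec : e < c / 2) :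
    |N' / D' - N / D| ≤ e * (2 / c + 2 * B / c ^ 2) := by
  have hD' : c / 2 ≤ D' := by linarith [(abs_le.1 h2).1]
  have hD0 : 0 < D := hc.trans_le hD
  have hD'0 : 0 < D' := by linarith
  have he : 0 ≤ e := (abs_nonneg _).trans h1
  have hB : 0 ≤ B := (abs_nonneg _).trans hN
  have e1 : N' / D' - N / D = (N' - N) / D' - N * (D' - D) / (D' * D) := by
    field_simp; ring
  have b1 : |(N' - N) / D'| ≤ e / (c / 2) := by
    rw [abs_div, abs_of_pos hD'0]; gcongr
  have b2 : |N * (D' - D) / (D' * D)| ≤ B * e / (c / 2 * c) := by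
    rw [abs_div, abs_mul, abs_of_pos (mul_pos hD'0 hD0)]; gcongr
  rw [e1]
  calc _ ≤ _ := abs_sub _ _
    _ ≤ e / (c / 2) + B * e / (c / 2 * c) := add_le_add b1 b2
    _ = _ := by field_simp

/-- Continuity of the Bayesian posterior predictive in the prior: in the setting of the
posterior-predictive continuity lemma, if priors `p_m` converge to `p` in the
`M`-weighted `L¹` sense (`∫ |p_m − p|·M dλ → 0`), then the numerators `N_{p_m}` converge
uniformly to `N_p`, the denominators `D_{p_m}` converge uniformly to `D_p`; moreover `D_p`
is bounded below by a positive constant, and consequently the posterior predictive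
densities `N_{p_m}/D_{p_m}` converge uniformly to `N_p/D_p`. -/
theorem posterior_predictive_continuous_in_prior
    {Θ : Type*} [MeasurableSpace Θ] (lam : Measure Θ) [SigmaFinite lam]
    {Y : Type*} [MetricSpace Y] [CompactSpace Y] (n : ℕ)
    (a : Θ × (Fin (n + 1) → Y) → ℝ) (b : Θ × (Fin n → Y) → ℝ)
    (ha0 : ∀ θ w, 0 ≤ a (θ, w)) (hb0 : ∀ θ v, 0 ≤ b (θ, v))
    (hameas : ∀ w, Measurable fun θ => a (θ, w))
    (hbmeas : ∀ v, Measurable fun θ => b (θ, v))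
    (hacont : ∀ᵐ θ ∂lam, Continuous fun w => a (θ, w))
    (hbcont : ∀ᵐ θ ∂lam, Continuous fun v => b (θ, v))
    (p M : Θ → ℝ) (hp0 : ∀ θ, 0 ≤ p θ) (hM0 : ∀ θ, 0 ≤ M θ)
    (hpmeas : Measurable p) (hMmeas : Measurable M)
    (haM : ∀ᵐ θ ∂lam, ∀ w, a (θ, w) ≤ M θ)
    (hbM : ∀ᵐ θ ∂lam, ∀ v, b (θ, v) ≤ M θ)
    (hpM : ∫⁻ θ, ENNReal.ofReal (p θ * M θ) ∂lam < ⊤)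
    (hD : ∀ v : Fin n → Y, 0 < ∫ θ, b (θ, v) * p θ ∂lam)
    (pseq : ℕ → Θ → ℝ) (hpseq0 : ∀ m θ, 0 ≤ pseq m θ)
    (hpseqmeas : ∀ m, Measurable (pseq m))
    (hL1 : Tendsto (fun m => ∫⁻ θ, ENNReal.ofReal (|pseq m θ - p θ| * M θ) ∂lam)
      atTop (nhds 0)) :
    TendstoUniformly
      (fun m (q : (Fin n → Y) × Y) => ∫ θ, a (θ, Fin.snoc q.1 q.2) * pseq m θ ∂lam)
      (fun q => ∫ θ, a (θ, Fin.snoc q.1 q.2) * p θ ∂lam) atTop ∧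
    TendstoUniformly
      (fun m (v : Fin n → Y) => ∫ θ, b (θ, v) * pseq m θ ∂lam)
      (fun v => ∫ θ, b (θ, v) * p θ ∂lam) atTop ∧
    (∃ c > 0, ∀ v : Fin n → Y, c ≤ ∫ θ, b (θ, v) * p θ ∂lam) ∧
    TendstoUniformly
      (fun m (q : (Fin n → Y) × Y) =>
        (∫ θ, a (θ, Fin.snoc q.1 q.2) * pseq m θ ∂lam) /
          (∫ θ, b (θ, q.1) * pseq m θ ∂lam))
      (fun q =>
        (∫ θ, a (θ, Fin.snoc q.1 q.2) * p θ ∂lam) / (∫ θ, b (θ, q.1) * p θ ∂lam))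
      atTop := by
  have hpI : Integrable (fun θ => |p θ| * M θ) lam := by
    simp only [abs_of_nonneg (hp0 _)]
    refine ⟨(hpmeas.mul hMmeas).aestronglyMeasurable, ?_⟩
    rwa [hasFiniteIntegral_iff_ofReal
      (Eventually.of_forall fun θ => mul_nonneg (hp0 θ) (hM0 θ))]
  have hdI : ∀ᶠ m in atTop, Integrable (fun θ => |pseq m θ - p θ| * M θ) lam := by
    filter_upwards [hL1.eventually (gt_mem_nhds ENNReal.zero_lt_top)] with m hm
    refine ⟨((((hpseqmeas m).sub hpmeas).abs).mul hMmeas).aestronglyMeasurable, ?_⟩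
    rwa [hasFiniteIntegral_iff_ofReal
      (Eventually.of_forall fun θ => mul_nonneg (abs_nonneg _) (hM0 θ))]
  have he : Tendsto (fun m => ∫ θ, |pseq m θ - p θ| * M θ ∂lam) atTop (nhds 0) := by
    have h := (ENNReal.tendsto_toReal ENNReal.zero_ne_top).comp hL1
    refine Tendsto.congr (fun m => ?_) h
    exact (integral_eq_lintegral_of_nonneg_ae
      (Eventually.of_forall fun θ => mul_nonneg (abs_nonneg _) (hM0 θ))
      ((((hpseqmeas m).sub hpmeas).abs).mul hMmeas).aestronglyMeasurable).symm
  have hA : ∀ᶠ m in atTop, ∀ q : (Fin n → Y) × Y,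
      |(∫ θ, a (θ, Fin.snoc q.1 q.2) * pseq m θ ∂lam) -
        ∫ θ, a (θ, Fin.snoc q.1 q.2) * p θ ∂lam| ≤ ∫ θ, |pseq m θ - p θ| * M θ ∂lam := by
    filter_upwards [hdI] with m hm q
    exact diff_bound lam (fun θ => a (θ, Fin.snoc q.1 q.2)) p (pseq m) M (fun θ => ha0 θ _)
      (hameas _) hpmeas (hpseqmeas m) (haM.mono fun θ h => h _) hpI hm
  have hB : ∀ᶠ m in atTop, ∀ v : Fin n → Y,
      |(∫ θ, b (θ, v) * pseq m θ ∂lam) -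
        ∫ θ, b (θ, v) * p θ ∂lam| ≤ ∫ θ, |pseq m θ - p θ| * M θ ∂lam := by
    filter_upwards [hdI] with m hm v
    exact diff_bound lam (fun θ => b (θ, v)) p (pseq m) M (fun θ => hb0 θ _)
      (hbmeas _) hpmeas (hpseqmeas m) (hbM.mono fun θ h => h _) hpI hm
  have hcont : Continuous fun v : Fin n → Y => ∫ θ, b (θ, v) * p θ ∂lam := by
    refine continuous_of_dominated
      (fun v => ((hbmeas v).mul hpmeas).aestronglyMeasurable) (fun v => ?_) hpI ?_
    · filter_upwards [hbM] with θ h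
      rw [Real.norm_eq_abs, abs_mul, abs_of_nonneg (hb0 θ v), mul_comm]
      exact mul_le_mul_of_nonneg_left (h v) (abs_nonneg _)
    · filter_upwards [hbcont] with θ h
      exact h.mul continuous_const
  have hc : ∃ c > 0, ∀ v : Fin n → Y, c ≤ ∫ θ, b (θ, v) * p θ ∂lam := by
    rcases isEmpty_or_nonempty (Fin n → Y) with hE | hE
    · exact ⟨1, one_pos, fun v => hE.elim v⟩
    · obtain ⟨v, -, hv⟩ := isCompact_univ.exists_isMinOn Set.univ_nonempty hcont.continuousOn
      exact ⟨_, hD v, fun w => hv (Set.mem_univ w)⟩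
  refine ⟨unif_of_bound _ _ _ he hA, unif_of_bound _ _ _ he hB, hc, ?_⟩
  obtain ⟨c, hc0, hcD⟩ := hc
  refine unif_of_bound _ _ (fun m => (∫ θ, |pseq m θ - p θ| * M θ ∂lam) *
    (2 / c + 2 * (∫ θ, |p θ| * M θ ∂lam) / c ^ 2)) ?_ ?_
  · simpa using he.mul_const (2 / c + 2 * (∫ θ, |p θ| * M θ ∂lam) / c ^ 2)
  · filter_upwards [hA, hB, he.eventually (gt_mem_nhds (half_pos hc0))] with m h1 h2 h3 q
    exact div_bound hc0 (int_of_env lam (fun θ => a (θ, Fin.snoc q.1 q.2)) p M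
      (fun θ => ha0 θ _) (hameas _) hpmeas (haM.mono fun θ h => h _) hpI).2
      (hcD q.1) (h1 q) (h2 q.1) h3
end

section
/- Let Y be a type, g : Y → ℝ, n ≥ 1, points y₁, …, yₙ ∈ Y, and α ∈ (0,1) with (n+1)·α not an integer. Set k := ⌊(n+1)·α⌋ and assume 1 ≤ k ≤ n. Let T be the k-th largest value among g(y₁), …, g(yₙ) (counted with multiplicity; i.e., T = s_{n+1−k} where s₁ ≤ ⋯ ≤ sₙ is the nondecreasing rearrangement of g(y₁), …, g(yₙ)). Then for every y ∈ Y: (|{i ∈ {1, …, n} : g(yᵢ) ≥ g(y)}| + 1) / (n+1) > α if and only if g(y) ≤ T. -/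
/-- Combinatorial core of the conformal region / level-set identity: with
`k = ⌊(n+1)·α⌋` (where `(n+1)·α` is not an integer and `1 ≤ k ≤ n`) and `T` the `k`-th
largest value among `g y₁, …, g yₙ` (i.e. `T = s (n − k)` for a nondecreasing
rearrangement `s` of `g ∘ ys`, 0-indexed, corresponding to `s_{n+1−k}` 1-indexed), we have
for every `y` that `(|{i : g (ys i) ≥ g y}| + 1)/(n+1) > α ↔ g y ≤ T`. -/
theorem conformal_rank_iff_levelSet {Y : Type*} (g : Y → ℝ) (n : ℕ) (hn : 1 ≤ n)
    (ys : Fin n → Y) (α : ℝ) (hα0 : 0 < α) (hα1 : α < 1)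
    (hnotint : ¬∃ m : ℤ, ((n : ℝ) + 1) * α = (m : ℝ))
    (k : ℕ) (hk : (k : ℤ) = ⌊((n : ℝ) + 1) * α⌋) (hk1 : 1 ≤ k) (hkn : k ≤ n)
    (s : Fin n → ℝ) (hmono : Monotone s)
    (σ : Equiv.Perm (Fin n)) (hperm : ∀ i, s i = g (ys (σ i)))
    (T : ℝ) (hT : T = s ⟨n - k, by omega⟩) :
    ∀ y : Y,
      (((Nat.card {i : Fin n // g (ys i) ≥ g y} : ℝ) + 1) / ((n : ℝ) + 1) > α ↔
        g y ≤ T) := by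
  intro y
  have hcard : Nat.card {i : Fin n // g (ys i) ≥ g y}
      = (Finset.univ.filter (fun i : Fin n => g y ≤ s i)).card := by
    rw [← Fintype.card_subtype, ← Nat.card_eq_fintype_card]
    refine (Nat.card_congr (σ.subtypeEquiv ?_)).symm
    intro i
    rw [hperm i]
  rw [hcard]
  have hfl := Int.floor_le (((n : ℝ) + 1) * α)
  have hlt := Int.lt_floor_add_one (((n : ℝ) + 1) * α)
  have hne : ((k : ℤ) : ℝ) ≠ ((n : ℝ) + 1) * α := fun h => hnotint ⟨k, h.symm⟩
  rw [← hk] at hfl hlt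
  have hfl' := lt_of_le_of_ne hfl hne
  push_cast at hfl' hlt
  have hpos : (0 : ℝ) < (n : ℝ) + 1 := by positivity
  rw [gt_iff_lt, lt_div_iff₀ hpos, mul_comm α]
  generalize hN : (Finset.univ.filter (fun i : Fin n => g y ≤ s i)).card = N
  have h1 : ((n : ℝ) + 1) * α < (N : ℝ) + 1 ↔ k ≤ N := by
    constructor
    · intro h
      have h2 : (k : ℝ) < ((N + 1 : ℕ) : ℝ) := by push_cast; linarith
      have h3 : k < N + 1 := by exact_mod_cast h2
      omega
    · intro h
      have h2 : (k : ℝ) ≤ (N : ℝ) := by exact_mod_cast h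
      linarith
  rw [h1, hT, ← hN]
  constructor
  · intro h
    by_contra hc
    have hsub : Finset.univ.filter (fun i : Fin n => g y ≤ s i)
        ⊆ Finset.Ioi (⟨n - k, by omega⟩ : Fin n) := by
      intro i hi
      rw [Finset.mem_filter] at hi
      rw [Finset.mem_Ioi]
      by_contra hle
      exact hc (hi.2.trans (hmono (not_lt.mp hle)))
    have := Finset.card_le_card hsub
    rw [Fin.card_Ioi] at this
    simp only at this
    omega
  · intro h
    have hsub : Finset.Ici (⟨n - k, by omega⟩ : Fin n)
        ⊆ Finset.univ.filter (fun i : Fin n => g y ≤ s i) := by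
      intro i hi
      rw [Finset.mem_Ici] at hi
      rw [Finset.mem_filter]
      exact ⟨Finset.mem_univ _, h.trans (hmono hi)⟩
    have := Finset.card_le_card hsub
    rw [Fin.card_Ici] at this
    simp only at this
    omega
end

section
/- Let (Θ, Σ_Θ, λ) and (W, Σ_W, ν) be measure spaces with λ and ν σ-finite. Let ℓ : W × Θ → ℝ be measurable and strictly positive with ∫_W ℓ(w, θ) dν(w) = 1 for every θ ∈ Θ (a likelihood density). Let p̄, p̲ : Θ → ℝ be measurable with p̄ strictly positive and p̲ nonnegative (upper and lower prior densities), and define the lower marginal likelihood ℓ̲(w) := ∫_Θ ℓ(w, θ)·p̲(θ) dλ(θ) and the upper posterior density p̄(θ ∣ w) := ℓ(w, θ)·p̄(θ) / ℓ̲(w). Then the upper posterior is an e-posterior, i.e., for every θ ∈ Θ one has ∫_W (1 / p̄(θ ∣ w)) · ℓ(w, θ) dν(w) ≤ 1, if and only if ∫_Θ p̲ dλ ≤ p̄(θ) for every θ ∈ Θ. -/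
open MeasureTheory

/-- The upper posterior `p̄(θ ∣ w) = ℓ(w,θ)·p̄(θ)/ℓ̲(w)`, with lower marginal likelihood
`ℓ̲(w) = ∫ ℓ(w,θ)·p̲(θ) dλ(θ)`, is an e-posterior (for each `θ` the statistic
`w ↦ 1/p̄(θ ∣ w)` has expectation at most 1 under the sampling density `ℓ(·, θ)`) if and
only if `∫ p̲ dλ ≤ p̄(θ)` for every `θ`. Integrals of nonnegative quantities are taken as
lower integrals (Fubini–Tonelli applies since all integrands are nonnegative measurable and
the measures σ-finite). -/
theorem upper_posterior_is_ePosterior_iff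
    {Θ W : Type*} [MeasurableSpace Θ] [MeasurableSpace W]
    (lam : Measure Θ) (ν : Measure W) [SigmaFinite lam] [SigmaFinite ν]
    (ℓ : W × Θ → ℝ) (hℓmeas : Measurable ℓ) (hℓpos : ∀ w θ, 0 < ℓ (w, θ))
    (hℓdens : ∀ θ, ∫⁻ w, ENNReal.ofReal (ℓ (w, θ)) ∂ν = 1)
    (pU pL : Θ → ℝ) (hpUmeas : Measurable pU) (hpLmeas : Measurable pL)
    (hpUpos : ∀ θ, 0 < pU θ) (hpL0 : ∀ θ, 0 ≤ pL θ) :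
    (∀ θ : Θ,
        ∫⁻ w, (ENNReal.ofReal (ℓ (w, θ) * pU θ) /
            ∫⁻ θ', ENNReal.ofReal (ℓ (w, θ') * pL θ') ∂lam)⁻¹ *
          ENNReal.ofReal (ℓ (w, θ)) ∂ν ≤ 1) ↔
      (∀ θ : Θ, ∫⁻ θ', ENNReal.ofReal (pL θ') ∂lam ≤ ENNReal.ofReal (pU θ)) := by
  refine forall_congr' fun θ => ?_
  have hu0 : ENNReal.ofReal (pU θ) ≠ 0 := by simpa using hpUpos θ
  have hut : ENNReal.ofReal (pU θ) ≠ ⊤ := ENNReal.ofReal_ne_top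
  have hm : Measurable fun z : W × Θ => ENNReal.ofReal (ℓ z * pL z.2) :=
    (hℓmeas.mul (hpLmeas.comp measurable_snd)).ennreal_ofReal
  have key : ∫⁻ w, ∫⁻ θ', ENNReal.ofReal (ℓ (w, θ') * pL θ') ∂lam ∂ν
      = ∫⁻ θ', ENNReal.ofReal (pL θ') ∂lam := by
    rw [lintegral_lintegral_swap hm.aemeasurable]
    refine lintegral_congr fun θ' => ?_
    have h1 : ∀ w, ENNReal.ofReal (ℓ (w, θ') * pL θ')
        = ENNReal.ofReal (ℓ (w, θ')) * ENNReal.ofReal (pL θ') :=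
      fun w => ENNReal.ofReal_mul (hℓpos w θ').le
    simp_rw [h1]
    rw [lintegral_mul_const' _ _ ENNReal.ofReal_ne_top, hℓdens, one_mul]
  have hint : ∀ w, (ENNReal.ofReal (ℓ (w, θ) * pU θ) /
            ∫⁻ θ', ENNReal.ofReal (ℓ (w, θ') * pL θ') ∂lam)⁻¹ *
          ENNReal.ofReal (ℓ (w, θ))
      = (∫⁻ θ', ENNReal.ofReal (ℓ (w, θ') * pL θ') ∂lam) * (ENNReal.ofReal (pU θ))⁻¹ := by
    intro w
    have ha0 : ENNReal.ofReal (ℓ (w, θ)) ≠ 0 := by simpa using hℓpos w θ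
    have hat : ENNReal.ofReal (ℓ (w, θ)) ≠ ⊤ := ENNReal.ofReal_ne_top
    rw [ENNReal.inv_div (Or.inr ENNReal.ofReal_ne_top)
      (Or.inr (by simpa using mul_pos (hℓpos w θ) (hpUpos θ))),
      ENNReal.ofReal_mul (hℓpos w θ).le, div_eq_mul_inv,
      ENNReal.mul_inv (Or.inl ha0) (Or.inl hat), mul_assoc,
      mul_right_comm, ENNReal.inv_mul_cancel ha0 hat, one_mul]
  simp_rw [hint]
  rw [lintegral_mul_const' _ _ (ENNReal.inv_ne_top.2 hu0), key, ← div_eq_mul_inv,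
    ENNReal.div_le_iff hu0 hut, one_mul]
end

section
/- Let (Y, Σ) be a measurable space, λ a σ-finite measure on it that is atomless (every measurable set A with λ(A) > 0 has a measurable subset B ⊆ A with 0 < λ(B) < λ(A)), and μ a probability measure on (Y, Σ) with μ absolutely continuous with respect to λ. Then: (a) if μ were maxitive, i.e., μ(A ∪ B) = max(μ(A), μ(B)) for all disjoint measurable A, B, then μ(A) ∈ {0, 1} for every measurable A; and (b) in fact μ cannot be maxitive: there exist disjoint measurable sets A, B with μ(A ∪ B) ≠ max(μ(A), μ(B)). -/
open MeasureTheory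

/-- A probability measure `μ` absolutely continuous with respect to an atomless σ-finite
measure `lam` cannot be maxitive: (a) if `μ` were maxitive (`μ(A ∪ B) = max (μ A) (μ B)`
for disjoint measurable `A, B`), then `μ A ∈ {0, 1}` for every measurable `A`; (b) in fact
there exist disjoint measurable `A, B` with `μ (A ∪ B) ≠ max (μ A) (μ B)`. -/
theorem absolutelyContinuous_not_maxitive
    {Y : Type*} [MeasurableSpace Y] (lam μ : Measure Y)
    [SigmaFinite lam] [IsProbabilityMeasure μ]
    (hatomless : ∀ A : Set Y, MeasurableSet A → 0 < lam A →
      ∃ B ⊆ A, MeasurableSet B ∧ 0 < lam B ∧ lam B < lam A)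
    (hac : μ ≪ lam) :
    ((∀ A B : Set Y, MeasurableSet A → MeasurableSet B → Disjoint A B →
        μ (A ∪ B) = max (μ A) (μ B)) →
      ∀ A : Set Y, MeasurableSet A → μ A = 0 ∨ μ A = 1) ∧
    ∃ A B : Set Y, MeasurableSet A ∧ MeasurableSet B ∧ Disjoint A B ∧
      μ (A ∪ B) ≠ max (μ A) (μ B) := by
  have h01 : (∀ A B : Set Y, MeasurableSet A → MeasurableSet B → Disjoint A B →
        μ (A ∪ B) = max (μ A) (μ B)) →
      ∀ A : Set Y, MeasurableSet A → μ A = 0 ∨ μ A = 1 := by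
    intro hmax A hA
    have h := hmax A Aᶜ hA hA.compl disjoint_compl_right
    rw [Set.union_compl_self, measure_univ] at h
    rcases max_choice (μ A) (μ Aᶜ) with h' | h'
    · right
      rw [h, h']
    · left
      rw [← h] at h'
      exact (prob_compl_eq_one_iff hA).1 h'.symm
  refine ⟨h01, ?_⟩
  by_contra hcon
  have hmax : ∀ A B : Set Y, MeasurableSet A → MeasurableSet B → Disjoint A B →
        μ (A ∪ B) = max (μ A) (μ B) := by
    intro A B hA hB hAB
    by_contra h
    exact hcon ⟨A, B, hA, hB, hAB, h⟩
  have hz := h01 hmax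
  have hf : Measurable (μ.rnDeriv lam) := Measure.measurable_rnDeriv μ lam
  have hμ : lam.withDensity (μ.rnDeriv lam) = μ := Measure.withDensity_rnDeriv_eq μ lam hac
  have hnull : ∀ A : Set Y, μ A = 0 ↔ lam ({x | μ.rnDeriv lam x ≠ 0} ∩ A) = 0 := by
    intro A
    have h := withDensity_apply_eq_zero (μ := lam) (s := A) hf
    rwa [hμ] at h
  have hS : MeasurableSet {x | μ.rnDeriv lam x ≠ 0} :=
    (measurableSet_eq_fun hf measurable_const).compl
  generalize {x | μ.rnDeriv lam x ≠ 0} = S at hnull hS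
  -- a piece of finite `lam`-measure and positive `μ`-measure
  obtain ⟨n, hn⟩ : ∃ n, μ (spanningSets lam n) ≠ 0 := by
    by_contra! h
    have h1 : μ (⋃ n, spanningSets lam n) = 0 := measure_iUnion_null h
    rw [iUnion_spanningSets, measure_univ] at h1
    exact one_ne_zero h1
  have hT : lam (S ∩ spanningSets lam n) ≠ 0 := fun h => hn ((hnull _).2 h)
  have hTm : MeasurableSet (S ∩ spanningSets lam n) := hS.inter (measurableSet_spanningSets lam n)
  obtain ⟨B, hBT, hB, hB0, hBlt⟩ := hatomless _ hTm (pos_iff_ne_zero.2 hT)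
  have hpos : ∀ A ⊆ S, MeasurableSet A → lam A ≠ 0 → μ A = 1 := by
    intro A hAS hA h
    refine (hz A hA).resolve_left fun h0 => h ?_
    have := (hnull A).1 h0
    rwa [Set.inter_eq_right.2 hAS] at this
  have hBS : B ⊆ S := hBT.trans Set.inter_subset_left
  have h1 : μ B = 1 := hpos B hBS hB hB0.ne'
  have hdiff : lam ((S ∩ spanningSets lam n) \ B) ≠ 0 := by
    intro h
    exact absurd (measure_mono_ae (ae_le_set.2 h)) (not_le.2 hBlt)
  have h2 : μ ((S ∩ spanningSets lam n) \ B) = 1 :=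
    hpos _ (Set.diff_subset.trans Set.inter_subset_left) (hTm.diff hB) hdiff
  have h3 : μ Bᶜ = 0 := (prob_compl_eq_zero_iff hB).2 h1
  have h4 : μ ((S ∩ spanningSets lam n) \ B) = 0 :=
    measure_mono_null (fun x hx => hx.2) h3
  rw [h2] at h4
  exact one_ne_zero h4
end
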